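/- arXiv:1303.2572 — 3 statements merged into one kernel-verified Lean document; each statement's English description precedes it below -/
import Mathlib

section
/- Let L be a first-order language having only relation symbols and let X be an L-structure with infinite domain X. If the poset ⟨P(X),⊆⟩ is atomic, then every element of P(X) is an atom and P(X) is a uniform filter base on X: every A ∈ P(X) has cardinality |X|, and for all A,B ∈ P(X) there is C ∈ P(X) with C ⊆ A ∩ B. Moreover, ⋂P(X) ∈ P(X) if and only if P(X) = {X}. -/
open FirstOrder

/-- For a relational language, every subset of an `L`-structure carries the induced structure. -/
instance setStructure (L : FirstOrder.Language) [L.IsRelational] {M : Type*} [L.Structure M]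
    (s : Set M) : L.Structure s where
  funMap f _ := isEmptyElim f
  RelMap r x := Language.Structure.RelMap r (fun i => (x i : M))

/-- `Copies L M` is the family of domains of substructures of `M` isomorphic to `M`. -/
def Copies (L : FirstOrder.Language) [L.IsRelational] (M : Type*) [L.Structure M] :
    Set (Set M) :=
  {A : Set M | Nonempty (L.Equiv A M)}

/-- Two elements of a family `S` of sets (a poset under `⊆`) are compatible iff they have a
common lower bound in `S`. -/
def Compat {M : Type*} (S : Set (Set M)) (p q : Set M) : Prop :=
  ∃ r ∈ S, r ⊆ p ∧ r ⊆ q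

/-- `p` is an atom of the poset `⟨S,⊆⟩` iff any two elements of `S` below `p` are compatible. -/
def IsForcingAtom {M : Type*} (S : Set (Set M)) (p : Set M) : Prop :=
  ∀ q ∈ S, q ⊆ p → ∀ r ∈ S, r ⊆ p → Compat S q r

/-- The poset `⟨S,⊆⟩` is atomless iff it has no atoms. -/
def Atomless {M : Type*} (S : Set (Set M)) : Prop :=
  ∀ p ∈ S, ¬ IsForcingAtom S p

/-- The poset `⟨S,⊆⟩` is atomic iff below every element there is an atom. -/
def Atomic {M : Type*} (S : Set (Set M)) : Prop :=
  ∀ p ∈ S, ∃ q ∈ S, q ⊆ p ∧ IsForcingAtom S q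

/-- The inclusion of a subset with its induced structure. -/
def setInclusion (L : FirstOrder.Language) [L.IsRelational] {M : Type*} [L.Structure M]
    (A : Set M) : L.Embedding A M where
  toFun := Subtype.val
  inj' := Subtype.val_injective
  map_fun' f := isEmptyElim f
  map_rel' _ _ := Iff.rfl

section Copies

variable {L : FirstOrder.Language} [L.IsRelational] {M : Type*} [L.Structure M]

theorem mem_copies_iff {A : Set M} :
    A ∈ Copies L M ↔ ∃ f : L.Embedding M M, Set.range f = A := by
  constructor
  · rintro ⟨e⟩
    refine ⟨(setInclusion L A).comp e.symm.toEmbedding, ?_⟩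
    ext x
    constructor
    · rintro ⟨y, rfl⟩
      exact (e.symm y).2
    · intro hx
      exact ⟨e ⟨x, hx⟩, congrArg Subtype.val (e.symm_apply_apply ⟨x, hx⟩)⟩
  · rintro ⟨f, rfl⟩
    let e : L.Equiv M (Set.range f) :=
      { toEquiv := Equiv.ofInjective f f.injective
        map_fun' := fun g => isEmptyElim g
        map_rel' := fun r x => f.map_rel r x }
    exact ⟨e.symm⟩

theorem univ_mem_copies : Set.univ ∈ Copies L M :=
  mem_copies_iff.2 ⟨Language.Embedding.refl L M, Set.range_id⟩

theorem image_mem_copies (f : L.Embedding M M) {A : Set M} (hA : A ∈ Copies L M) :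
    f '' A ∈ Copies L M := by
  obtain ⟨g, rfl⟩ := mem_copies_iff.1 hA
  exact mem_copies_iff.2 ⟨f.comp g, Set.range_comp f g⟩

theorem preimage_mem_copies (f : L.Embedding M M) {C : Set M} (hC : C ∈ Copies L M)
    (hCf : C ⊆ Set.range f) : f ⁻¹' C ∈ Copies L M := by
  obtain ⟨g, rfl⟩ := mem_copies_iff.1 hC
  choose k hk using fun x => hCf ⟨x, rfl⟩
  have hfk : f ∘ k = g := funext hk
  refine mem_copies_iff.2 ⟨
    { toFun := k
      inj' := fun x y hxy => g.injective (by rw [← hk x, ← hk y, hxy])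
      map_fun' := fun s => isEmptyElim s
      map_rel' := fun r x => by
        rw [← f.map_rel, ← Function.comp_assoc, hfk, g.map_rel] }, ?_⟩
  ext y
  constructor
  · rintro ⟨x, rfl⟩
    exact ⟨x, (hk x).symm⟩
  · rintro ⟨x, hx⟩
    exact ⟨x, f.injective ((hk x).trans hx)⟩

theorem exists_copy_subset_inter (h : Atomic (Copies L M)) {A B : Set M}
    (hA : A ∈ Copies L M) (hB : B ∈ Copies L M) : ∃ C ∈ Copies L M, C ⊆ A ∩ B := by
  obtain ⟨q, hq, -, hatom⟩ := h _ univ_mem_copies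
  obtain ⟨f, rfl⟩ := mem_copies_iff.1 hq
  obtain ⟨C, hC, hCA, hCB⟩ := hatom _ (image_mem_copies f hA) (Set.image_subset_range f A)
    _ (image_mem_copies f hB) (Set.image_subset_range f B)
  refine ⟨f ⁻¹' C, preimage_mem_copies f hC (hCA.trans (Set.image_subset_range f A)), ?_⟩
  intro x hx
  exact ⟨f.injective.mem_set_image.1 (hCA hx), f.injective.mem_set_image.1 (hCB hx)⟩

theorem sInter_copies_mem_iff :
    ⋂₀ Copies L M ∈ Copies L M ↔ Copies L M = {Set.univ} := by
  constructor
  · intro hI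
    obtain ⟨f, hf⟩ := mem_copies_iff.1 hI
    refine Set.eq_singleton_iff_unique_mem.2 ⟨univ_mem_copies, fun A hA => ?_⟩
    refine Set.eq_univ_of_forall fun x => ?_
    have hx : f x ∈ ⋂₀ Copies L M := hf ▸ Set.mem_range_self x
    exact f.injective.mem_set_image.1 (hx _ (image_mem_copies f hA))
  · intro hP
    rw [hP, Set.sInter_singleton]
    rfl

end Copies

/-- If `X` is infinite and `⟨P(X),⊆⟩` is atomic, then every element of `P(X)` is an atom and
`P(X)` is a uniform filter base on `X`; moreover `⋂ P(X) ∈ P(X)` iff `P(X) = {X}`. -/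
theorem copies_atomic_uniform_filter_base (L : FirstOrder.Language) [L.IsRelational]
    (M : Type*) [L.Structure M] [Infinite M] (h : Atomic (Copies L M)) :
    (∀ p ∈ Copies L M, IsForcingAtom (Copies L M) p) ∧
    (∀ A ∈ Copies L M, Cardinal.mk A = Cardinal.mk M) ∧
    (∀ A ∈ Copies L M, ∀ B ∈ Copies L M, ∃ C ∈ Copies L M, C ⊆ A ∩ B) ∧
    (⋂₀ Copies L M ∈ Copies L M ↔ Copies L M = {Set.univ}) := by
  refine ⟨fun p _ q hq _ r hr _ => ?_, fun A hA => ?_,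
    fun A hA B hB => exists_copy_subset_inter h hA hB, sInter_copies_mem_iff⟩
  · obtain ⟨C, hC, hCqr⟩ := exists_copy_subset_inter h hq hr
    exact ⟨C, hC, Set.subset_inter_iff.1 hCqr⟩
  · obtain ⟨e⟩ := hA
    exact Cardinal.mk_congr e.toEquiv
end

section
/- Let L be a first-order language having only relation symbols and let X be an L-structure. Then the poset ⟨P(X),⊆⟩ is atomic if and only if A ≤* B holds for all A,B ∈ P(X), where A ≤* B means that for every C ∈ P(X) with C ⊆ A there exists D ∈ P(X) with D ⊆ C ∩ B. (Equivalently, the separative quotient of ⟨P(X),⊆⟩ has exactly one element iff the poset is atomic.) -/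
open FirstOrder

/-- The separative-modification order on `P(X)`: `A ≤* B` iff every `C ∈ P(X)` with `C ⊆ A`
has some `D ∈ P(X)` with `D ⊆ C ∩ B`. -/
def leStar {M : Type*} (S : Set (Set M)) (A B : Set M) : Prop :=
  ∀ C ∈ S, C ⊆ A → ∃ D ∈ S, D ⊆ C ∩ B

/-- An embedding `f : M ↪[L] M` restricts to an isomorphism from any set onto its image. -/
noncomputable def FirstOrder.Language.Embedding.equivImage {L : FirstOrder.Language}
    [L.IsRelational] {M : Type*} [L.Structure M] (f : M ↪[L] M) (A : Set M) :
    L.Equiv A (f '' A) where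
  toEquiv := Equiv.Set.image f A f.injective
  map_fun' g := isEmptyElim g
  map_rel' r x := f.map_rel r fun i => (x i : M)

theorem image_mem_copies_iff {L : FirstOrder.Language} [L.IsRelational] {M : Type*}
    [L.Structure M] (f : M ↪[L] M) (A : Set M) : f '' A ∈ Copies L M ↔ A ∈ Copies L M :=
  ⟨fun ⟨e⟩ => ⟨e.comp (f.equivImage A)⟩, fun ⟨e⟩ => ⟨e.comp (f.equivImage A).symm⟩⟩

theorem exists_embedding_range_eq {L : FirstOrder.Language} [L.IsRelational] {M : Type*}
    [L.Structure M] {p : Set M} (hp : p ∈ Copies L M) :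
    ∃ f : M ↪[L] M, Set.range f = p := by
  obtain ⟨e⟩ := hp
  let f : M ↪[L] M :=
    { toFun := fun x => (e.symm x : M)
      inj' := Subtype.val_injective.comp e.symm.injective
      map_fun' := fun g => isEmptyElim g
      map_rel' := fun r x => e.symm.map_rel r x }
  refine ⟨f, ?_⟩
  change Set.range (Subtype.val ∘ e.symm) = p
  rw [e.symm.surjective.range_comp, Subtype.range_coe]

/-- If some copy is an atom, then any two copies are compatible, since the copies below it form
an isomorphic image of the whole poset. -/
theorem compat_of_isForcingAtom {L : FirstOrder.Language} [L.IsRelational] {M : Type*}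
    [L.Structure M] {p : Set M} (hp : p ∈ Copies L M) (hatom : IsForcingAtom (Copies L M) p)
    {A B : Set M} (hA : A ∈ Copies L M) (hB : B ∈ Copies L M) : Compat (Copies L M) A B := by
  obtain ⟨f, rfl⟩ := exists_embedding_range_eq hp
  obtain ⟨r, hr, hrA, hrB⟩ :=
    hatom _ ((image_mem_copies_iff f A).2 hA) (Set.image_subset_range f A)
      _ ((image_mem_copies_iff f B).2 hB) (Set.image_subset_range f B)
  obtain ⟨D, hDA, rfl⟩ := Set.subset_image_iff.1 hrA
  exact ⟨D, (image_mem_copies_iff f D).1 hr, hDA, (Set.image_subset_image_iff f.injective).1 hrB⟩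

/-- `⟨P(X),⊆⟩` is atomic iff `A ≤* B` for all `A, B ∈ P(X)` (i.e. iff the separative quotient
is a single point). -/
theorem copies_atomic_iff_leStar (L : FirstOrder.Language) [L.IsRelational]
    (M : Type*) [L.Structure M] :
    Atomic (Copies L M) ↔
      ∀ A ∈ Copies L M, ∀ B ∈ Copies L M, leStar (Copies L M) A B := by
  constructor
  · intro h A hA B hB C hC _
    obtain ⟨p, hp, -, hatom⟩ := h A hA
    obtain ⟨D, hD, hDC, hDB⟩ := compat_of_isForcingAtom hp hatom hC hB
    exact ⟨D, hD, Set.subset_inter hDC hDB⟩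
  · intro h p hp
    refine ⟨p, hp, subset_rfl, fun q hq _ r hr _ => ?_⟩
    obtain ⟨D, hD, hDqr⟩ := h q hq r hr q hq subset_rfl
    exact ⟨D, hD, Set.subset_inter_iff.1 hDqr⟩
end

section
/- Let X = ⟨ℕ,ρ⟩ be a binary structure. The following are equivalent: (a) P(X) equals the set of all infinite subsets of ℕ; (b) P(X) is dense in ⟨[ℕ]^ω,⊆⟩, i.e. every infinite A ⊆ ℕ has a subset belonging to P(X); (c) P(X) is somewhere dense in ⟨[ℕ]^ω,⊆⟩, i.e. there is an infinite A ⊆ ℕ such that every infinite B ⊆ A has a subset belonging to P(X); (d) I_X = Fin, i.e. I_X is exactly the family of finite subsets of ℕ. Consequently, P(X) either equals the set of all infinite subsets of ℕ or is a nowhere dense subset of ⟨[ℕ]^ω,⊆⟩. -/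
/-- `f` is an embedding of the binary structure `⟨X,ρ⟩` into `⟨Y,σ⟩`: an injection preserving
the relation in both directions. -/
def BinEmb {X Y : Type*} (ρ : X → X → Prop) (σ : Y → Y → Prop) (f : X → Y) : Prop :=
  Function.Injective f ∧ ∀ x₁ x₂, ρ x₁ x₂ ↔ σ (f x₁) (f x₂)

/-- The binary structures `⟨X,ρ⟩` and `⟨Y,σ⟩` are isomorphic: there is a bijection preserving
the relation in both directions. -/
def BinIso {X Y : Type*} (ρ : X → X → Prop) (σ : Y → Y → Prop) : Prop :=
  ∃ e : X ≃ Y, ∀ x₁ x₂, ρ x₁ x₂ ↔ σ (e x₁) (e x₂)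

/-- `P(X)` for a binary structure `⟨X,ρ⟩`: the family of sets `A ⊆ X` whose induced
substructure is isomorphic to `⟨X,ρ⟩`. -/
def BinCopies {X : Type*} (ρ : X → X → Prop) : Set (Set X) :=
  {A : Set X | BinIso ρ (fun a b : A => ρ a b)}

/-- `I_X`: the family of subsets of the domain containing no copy of the structure. -/
def BinIdeal {X : Type*} (ρ : X → X → Prop) : Set (Set X) :=
  {S : Set X | ¬ ∃ A ∈ BinCopies ρ, A ⊆ S}

/-- Infinite Ramsey theorem for ordered pairs and finitely many colours. -/
theorem exists_injective_seq_monochromatic {α κ : Type*} [Infinite α] [Finite κ]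
    (c : α → α → κ) :
    ∃ (f : ℕ → α) (k : κ), Function.Injective f ∧ ∀ m n, m < n → c (f m) (f n) = k := by
  let U := Filter.hyperfilter α
  have limit : ∀ g : α → κ, ∃ k, ∀ᶠ x in (U : Filter α), g x = k := fun g ↦ by
    obtain ⟨k, hk⟩ := (U.map g).eq_pure_of_finite
    have : ({k} : Set κ) ∈ U.map g := by rw [hk]; exact Ultrafilter.mem_pure.2 rfl
    exact ⟨k, this⟩
  choose l hl using fun x ↦ limit (c x)
  obtain ⟨k, hk⟩ := limit l
  obtain ⟨f, -, hf⟩ := exists_seq_of_forall_finset_exists (fun x ↦ l x = k)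
    (fun x y ↦ x ≠ y ∧ c x y = k) fun s hs ↦ by
      have hc : ∀ᶠ y in (U : Filter α), ∀ x ∈ s, x ≠ y ∧ c x y = k := by
        rw [Filter.eventually_all_finset]
        intro x hx
        have hne : ∀ᶠ y in (U : Filter α), x ≠ y := by
          have := Filter.compl_mem_hyperfilter_of_finite (Set.finite_singleton x)
          filter_upwards [this] with y hy h
          exact hy h.symm
        filter_upwards [hne, hl x] with y hy hxy
        exact ⟨hy, hxy.trans (hs x hx)⟩
      exact (hk.and hc).exists
  refine ⟨f, k, fun m n h ↦ ?_, fun m n h ↦ (hf m n h).2⟩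
  rcases lt_trichotomy m n with hmn | hmn | hmn
  · exact absurd h (hf m n hmn).1
  · exact hmn
  · exact absurd h.symm (hf n m hmn).1

theorem BinIso.symm {X Y : Type*} {ρ : X → X → Prop} {σ : Y → Y → Prop} (h : BinIso ρ σ) :
    BinIso σ ρ := by
  obtain ⟨e, he⟩ := h
  exact ⟨e.symm, fun x y ↦ by simp [he]⟩

theorem BinIso.trans {X Y Z : Type*} {ρ : X → X → Prop} {σ : Y → Y → Prop} {τ : Z → Z → Prop}
    (h : BinIso ρ σ) (h' : BinIso σ τ) : BinIso ρ τ := by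
  obtain ⟨e, he⟩ := h
  obtain ⟨e', he'⟩ := h'
  exact ⟨e.trans e', fun x y ↦ (he x y).trans (he' _ _)⟩

/-- An embedding restricts to an isomorphism from a substructure onto its image. -/
theorem BinEmb.binIso_image {X Y : Type*} {ρ : X → X → Prop} {σ : Y → Y → Prop} {f : X → Y}
    (hf : BinEmb ρ σ f) (S : Set X) :
    BinIso (fun a b : S ↦ ρ a b) (fun a b : f '' S ↦ σ a b) :=
  ⟨Equiv.Set.image f S hf.1, fun x y ↦ hf.2 x y⟩

theorem mem_binCopies_iff {X : Type*} {ρ : X → X → Prop} {A : Set X} :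
    A ∈ BinCopies ρ ↔ BinIso ρ (fun a b : A ↦ ρ a b) :=
  Iff.rfl

theorem infinite_of_mem_binCopies {X : Type*} [Infinite X] {ρ : X → X → Prop} {A : Set X}
    (h : A ∈ BinCopies ρ) : A.Infinite := by
  obtain ⟨e, -⟩ := h
  exact Set.infinite_coe_iff.1 (Infinite.of_injective e e.injective)

/-- If strictly increasing maps preserve a relation on `ℕ`, then every infinite set carries a
copy of it. -/
theorem mem_binCopies_of_strictMono_invariant {σ : ℕ → ℕ → Prop}
    (hσ : ∀ g : ℕ → ℕ, StrictMono g → ∀ m n, σ m n ↔ σ (g m) (g n))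
    {D : Set ℕ} (hD : D.Infinite) : D ∈ BinCopies σ := by
  classical
  have := hD.to_subtype
  let e := Nat.Subtype.orderIsoOfNat D
  exact ⟨e.toEquiv, hσ (fun n ↦ e n) fun _ _ h ↦ e.strictMono h⟩

theorem mem_binCopies_of_binIso {X Y : Type*} {ρ : X → X → Prop} {σ : Y → Y → Prop}
    [Infinite X] (h : BinIso ρ σ) (hσ : ∀ D : Set Y, D.Infinite → D ∈ BinCopies σ)
    {S : Set X} (hS : S.Infinite) : S ∈ BinCopies ρ := by
  have ⟨e, he⟩ := h
  have himage : BinEmb ρ σ e := ⟨e.injective, he⟩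
  have hcopy := mem_binCopies_iff.1 (hσ _ (hS.image e.injective.injOn))
  exact (h.trans hcopy).trans (himage.binIso_image S).symm

/-- If the copies are somewhere dense, then every infinite set is a copy. -/
theorem mem_binCopies_of_somewhere_dense {ρ : ℕ → ℕ → Prop} {A : Set ℕ} (hA : A.Infinite)
    (hd : ∀ B ⊆ A, B.Infinite → ∃ C ∈ BinCopies ρ, C ⊆ B) {S : Set ℕ} (hS : S.Infinite) :
    S ∈ BinCopies ρ := by
  have := hA.to_subtype
  obtain ⟨f, ⟨p, q, r⟩, hf, hc⟩ := exists_injective_seq_monochromatic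
    fun x y : A ↦ (ρ x y, ρ y x, ρ x x)
  simp only [Prod.mk.injEq] at hc
  let g : ℕ → ℕ := fun n ↦ f n
  have hg : Function.Injective g := Subtype.val_injective.comp hf
  let σ : ℕ → ℕ → Prop := fun m n ↦ ρ (g m) (g n)
  have hemb : BinEmb σ ρ g := ⟨hg, fun _ _ ↦ Iff.rfl⟩
  have hσ : ∀ u : ℕ → ℕ, StrictMono u → ∀ m n, σ m n ↔ σ (u m) (u n) := by
    intro u hu m n
    rcases lt_trichotomy m n with h | rfl | h
    · exact iff_of_eq ((hc _ _ h).1.trans (hc _ _ (hu h)).1.symm)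
    · exact iff_of_eq ((hc _ _ (Nat.lt_succ_self m)).2.2.trans
        (hc _ _ (Nat.lt_succ_self (u m))).2.2.symm)
    · exact iff_of_eq ((hc _ _ h).2.1.trans (hc _ _ (hu h)).2.1.symm)
  obtain ⟨C, hC, hCg⟩ := hd (Set.range g) (by rintro _ ⟨n, rfl⟩; exact (f n).2)
    (Set.infinite_range_of_injective hg)
  obtain ⟨D, rfl⟩ := Set.subset_range_iff_exists_image_eq.1 hCg
  have hD : D.Infinite := (infinite_of_mem_binCopies hC).of_image g
  have hcopy : ∀ {D : Set ℕ}, D.Infinite → D ∈ BinCopies σ :=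
    mem_binCopies_of_strictMono_invariant hσ
  have hiso : BinIso ρ σ :=
    ((mem_binCopies_iff.1 hC).trans (hemb.binIso_image D).symm).trans
      (mem_binCopies_iff.1 (hcopy hD)).symm
  exact mem_binCopies_of_binIso hiso (fun _ ↦ hcopy) hS

/-- For a binary structure `X = ⟨ℕ,ρ⟩` the following are equivalent: (a) `P(X)` is the family
of all infinite subsets of `ℕ`; (b) `P(X)` is dense in `⟨[ℕ]^ω,⊆⟩`; (c) `P(X)` is somewhere
dense in `⟨[ℕ]^ω,⊆⟩`; (d) `I_X = Fin`. Consequently `P(X)` equals the family of all infinite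
sets or is nowhere dense in `⟨[ℕ]^ω,⊆⟩`. -/
theorem binCopies_dense_tfae (ρ : ℕ → ℕ → Prop) :
    ((BinCopies ρ = {A : Set ℕ | A.Infinite}) ↔
      (∀ A : Set ℕ, A.Infinite → ∃ C ∈ BinCopies ρ, C ⊆ A)) ∧
    ((∀ A : Set ℕ, A.Infinite → ∃ C ∈ BinCopies ρ, C ⊆ A) ↔
      (∃ A : Set ℕ, A.Infinite ∧ ∀ B ⊆ A, B.Infinite → ∃ C ∈ BinCopies ρ, C ⊆ B)) ∧
    ((∃ A : Set ℕ, A.Infinite ∧ ∀ B ⊆ A, B.Infinite → ∃ C ∈ BinCopies ρ, C ⊆ B) ↔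
      (BinIdeal ρ = {S : Set ℕ | S.Finite})) ∧
    ((BinCopies ρ = {A : Set ℕ | A.Infinite}) ∨
      ¬ ∃ A : Set ℕ, A.Infinite ∧ ∀ B ⊆ A, B.Infinite → ∃ C ∈ BinCopies ρ, C ⊆ B) := by
  have hca : (∃ A : Set ℕ, A.Infinite ∧ ∀ B ⊆ A, B.Infinite → ∃ C ∈ BinCopies ρ, C ⊆ B) →
      BinCopies ρ = {A : Set ℕ | A.Infinite} := by
    rintro ⟨A, hA, hd⟩
    exact Set.Subset.antisymm (fun _ ↦ infinite_of_mem_binCopies)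
      fun _ ↦ mem_binCopies_of_somewhere_dense hA hd
  have hab : BinCopies ρ = {A : Set ℕ | A.Infinite} →
      ∀ A : Set ℕ, A.Infinite → ∃ C ∈ BinCopies ρ, C ⊆ A :=
    fun h A hA ↦ ⟨A, h ▸ hA, subset_rfl⟩
  have hbc : (∀ A : Set ℕ, A.Infinite → ∃ C ∈ BinCopies ρ, C ⊆ A) →
      ∃ A : Set ℕ, A.Infinite ∧ ∀ B ⊆ A, B.Infinite → ∃ C ∈ BinCopies ρ, C ⊆ B :=
    fun h ↦ ⟨Set.univ, Set.infinite_univ, fun B _ ↦ h B⟩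
  have hbd : (∀ A : Set ℕ, A.Infinite → ∃ C ∈ BinCopies ρ, C ⊆ A) ↔
      BinIdeal ρ = {S : Set ℕ | S.Finite} := by
    constructor
    · intro h
      ext S
      refine ⟨fun hS ↦ ?_, ?_⟩
      · by_contra hinf
        exact hS (h S hinf)
      · rintro hS ⟨C, hC, hCS⟩
        exact infinite_of_mem_binCopies hC (Set.Finite.subset hS hCS)
    · intro h A hA
      by_contra hno
      have hmem : A ∈ BinIdeal ρ := hno
      rw [h] at hmem
      exact hA hmem
  refine ⟨⟨hab, fun h ↦ hca (hbc h)⟩, ⟨hbc, fun h ↦ hab (hca h)⟩,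
    ⟨fun h ↦ hbd.1 (hab (hca h)), fun h ↦ hbc (hbd.2 h)⟩, ?_⟩
  by_cases h : BinCopies ρ = {A : Set ℕ | A.Infinite}
  · exact Or.inl h
  · exact Or.inr fun hc ↦ h (hca hc)
end
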